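/- arXiv:2008.02418 — 2 statements merged into one kernel-verified Lean document; each statement's English description precedes it below -/
import Mathlib

section
/- Lemma 3.3 (UGM for the Beckmann model): assume points t^0, …, t^N ≥ t̄, constants L_1, …, L_N > 0, and subgradients g^k of Φ at t^k with −g^k = Θx^k for some x^k ∈ X satisfy Q(t̂^N) ≤ min_{t ≥ t̄} { (1/S_N) ∑_{k=0}^{N−1} (1/L_{k+1}) [Φ(t^k) + ⟨g^k, t − t^k⟩] + h(t) + ‖t − t̄‖₂²/S_N } + ε/2, where h(t) = ∑_e σ_e*(t_e), S_N = ∑_{k=1}^N 1/L_k, t̂^N = (1/S_N) ∑_{k=1}^N t^k/L_k, f̂^N = −(1/S_N) ∑_{k=0}^{N−1} g^k/L_{k+1}, and t* minimizes Q over {t ≥ t̄} with R = ‖t* − t̄‖₂. Then: (i) Q(t̂^N) − Q(t*) ≤ R²/S_N + ε/2, and (ii) 0 ≤ Q(t̂^N) + Ψ(f̂^N) ≤ ‖τ(f̂^N) − t̄‖₂²/S_N + ε/2, where τ(f)_e = τ_e(f_e). -/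
open Finset

/-- Closed form of the Beckmann cost integral. -/
theorem integral_beckmann_cost {b c ρ μ x : ℝ} (hc : 0 < c) (hμ : 0 < μ) :
    ∫ z in (0:ℝ)..x, b * (1 + ρ * (z / c) ^ (1 / μ)) =
      b * c * (x / c + ρ * (μ / (1 + μ) * (x / c) ^ (1 / μ + 1))) := by
  have hp : 0 < 1 / μ := by positivity
  have hcont : Continuous fun z : ℝ => ρ * (z / c) ^ (1 / μ) :=
    continuous_const.mul ((continuous_id.div_const c).rpow_const fun _ => Or.inr hp.le)
  rw [intervalIntegral.integral_const_mul,
    intervalIntegral.integral_add (by simp) (hcont.intervalIntegrable _ _),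
    intervalIntegral.integral_const_mul,
    intervalIntegral.integral_comp_div (fun y : ℝ => y ^ (1 / μ)) hc.ne',
    integral_rpow (Or.inl (by linarith)), zero_div, Real.zero_rpow (by positivity)]
  simp only [intervalIntegral.integral_const, smul_eq_mul]
  field_simp
  ring

/-- Young's inequality with the conjugate exponents `1 / μ + 1` and `μ + 1`. -/
theorem young_inequality_beckmann {μ u y : ℝ} (hμ : 0 < μ) (hu : 0 ≤ u) (hy : 0 ≤ y) :
    u * y ≤ μ / (1 + μ) * u ^ (1 / μ + 1) + y ^ μ * y / (1 + μ) := by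
  have hpq : (1 / μ + 1).HolderConjugate (μ + 1) := by
    rw [Real.holderConjugate_iff]
    refine ⟨by linarith [show 0 < 1 / μ by positivity], ?_⟩
    field_simp
    ring
  have h := Real.young_inequality_of_nonneg hu hy hpq
  rw [Real.rpow_add_one' hy (by positivity)] at h
  refine h.trans (le_of_eq ?_)
  field_simp
  ring

/-- Fenchel-Young inequality for the Beckmann cost and its conjugate. -/
theorem fenchel_young_beckmann {b c ρ μ x t : ℝ} (hb : 0 < b) (hc : 0 < c) (hρ : 0 < ρ)
    (hμ : 0 < μ) (hx : 0 ≤ x) (ht : b ≤ t) :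
    t * x ≤ (∫ z in (0:ℝ)..x, b * (1 + ρ * (z / c) ^ (1 / μ))) +
      c * ((t - b) / (b * ρ)) ^ μ * (t - b) / (1 + μ) := by
  rw [integral_beckmann_cost hc hμ]
  obtain ⟨y, rfl⟩ : ∃ y, t = b * (1 + ρ * y) :=
    ⟨(t - b) / (b * ρ), by field_simp; ring⟩
  obtain ⟨u, rfl⟩ : ∃ u, x = u * c := ⟨x / c, by field_simp⟩
  have hy : 0 ≤ y := by
    have h : 0 ≤ b * ρ * y := by linarith
    exact nonneg_of_mul_nonneg_right h (by positivity)
  have hu : 0 ≤ u := nonneg_of_mul_nonneg_left hx hc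
  have hq : (b * (1 + ρ * y) - b) / (b * ρ) = y := by field_simp; ring
  rw [hq, mul_div_cancel_right₀ u hc.ne']
  have h := mul_le_mul_of_nonneg_left (young_inequality_beckmann hμ hu hy)
    (show 0 ≤ b * c * ρ by positivity)
  calc b * (1 + ρ * y) * (u * c) = b * c * u + b * c * ρ * (u * y) := by ring
    _ ≤ b * c * u +
        b * c * ρ * (μ / (1 + μ) * u ^ (1 / μ + 1) + y ^ μ * y / (1 + μ)) := by gcongr
    _ = _ := by ring

/-- Equality case of the Fenchel-Young inequality at `t = τ(x)`. -/
theorem fenchel_young_beckmann_eq {b c ρ μ x : ℝ} (hb : 0 < b) (hc : 0 < c) (hρ : 0 < ρ)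
    (hμ : 0 < μ) (hx : 0 ≤ x) :
    (∫ z in (0:ℝ)..x, b * (1 + ρ * (z / c) ^ (1 / μ))) +
      c * ((b * (1 + ρ * (x / c) ^ (1 / μ)) - b) / (b * ρ)) ^ μ *
        (b * (1 + ρ * (x / c) ^ (1 / μ)) - b) / (1 + μ) =
      b * (1 + ρ * (x / c) ^ (1 / μ)) * x := by
  rw [integral_beckmann_cost hc hμ]
  obtain ⟨u, rfl⟩ : ∃ u, x = u * c := ⟨x / c, by field_simp⟩
  have hu : 0 ≤ u := nonneg_of_mul_nonneg_left hx hc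
  have hp : 0 < 1 / μ := by positivity
  rw [mul_div_cancel_right₀ u hc.ne', Real.rpow_add_one' hu (by positivity)]
  have hpow : (u ^ (1 / μ)) ^ μ = u := by
    rw [← Real.rpow_mul hu, one_div_mul_cancel hμ.ne', Real.rpow_one]
  set y := u ^ (1 / μ)
  have hq : (b * (1 + ρ * y) - b) / (b * ρ) = y := by field_simp; ring
  rw [hq, hpow]
  field_simp
  ring

/-- The cost of any feasible path flow is at least that of routing along shortest paths. -/
theorem sum_demand_mul_inf'_le {E P W : Type*} [Fintype E] [Fintype P] [Fintype W]
    [DecidableEq W] (a : P → E → ℝ) (wOD : P → W) (d : W → ℝ)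
    (hne : ∀ w : W, (univ.filter (fun p => wOD p = w)).Nonempty)
    (x : P → ℝ) (hx : ∀ p, 0 ≤ x p)
    (hxd : ∀ w, ∑ p ∈ univ.filter (fun p => wOD p = w), x p = d w) (t : E → ℝ) :
    ∑ w, d w * (univ.filter (fun p => wOD p = w)).inf' (hne w) (fun p => ∑ e, t e * a p e) ≤
      ∑ e, (∑ p, a p e * x p) * t e := by
  have hswap : ∑ e, (∑ p, a p e * x p) * t e = ∑ p, x p * ∑ e, t e * a p e := by
    simp only [sum_mul, mul_sum]
    rw [sum_comm]
    exact sum_congr rfl fun p _ => sum_congr rfl fun e _ => by ring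
  rw [hswap, ← sum_fiberwise_of_maps_to (s := univ) (t := univ) (g := wOD)
    (fun p _ => mem_univ _)]
  refine sum_le_sum fun w _ => ?_
  rw [← hxd w, sum_mul]
  exact sum_le_sum fun p hp => mul_le_mul_of_nonneg_left (inf'_le _ hp) (hx p)

/-- Lemma 3.3 (UGM for the Beckmann model): under the universal gradient
inequality with composite term `h(t) = ∑_e σ_e*(t_e)`, one has
(i) `Q(t̂^N) − Q(t*) ≤ R²/S_N + ε/2`, and
(ii) `0 ≤ Q(t̂^N) + Ψ(f̂^N) ≤ ‖τ(f̂^N) − t̄‖₂²/S_N + ε/2`. -/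
theorem ugm_beckmann_lemma
    (E P W : Type) [Fintype E] [Fintype P] [Fintype W] [DecidableEq W]
    (a : P → E → ℝ) (ha : ∀ p e, a p e = 0 ∨ a p e = 1)
    (wOD : P → W) (d : W → ℝ) (hd : ∀ w, 0 < d w)
    (hne : ∀ w : W, (univ.filter (fun p => wOD p = w)).Nonempty)
    (Φ : (E → ℝ) → ℝ)
    (hΦ : ∀ t : E → ℝ, Φ t = -∑ w, d w *
        (univ.filter (fun p => wOD p = w)).inf' (hne w) (fun p => ∑ e, t e * a p e))
    (tbar fbar : E → ℝ) (htbar : ∀ e, 0 < tbar e) (hfbar : ∀ e, 0 < fbar e)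
    (ρ μ : ℝ) (hρ : 0 < ρ) (hμ0 : 0 < μ) (hμ1 : μ ≤ 1)
    (τ : E → ℝ → ℝ)
    (hτ : ∀ e (x : ℝ), τ e x = tbar e * (1 + ρ * (x / fbar e) ^ (1 / μ)))
    (σ : E → ℝ → ℝ) (hσ : ∀ e (x : ℝ), σ e x = ∫ z in (0:ℝ)..x, τ e z)
    (Ψ : (E → ℝ) → ℝ) (hΨ : ∀ f : E → ℝ, Ψ f = ∑ e, σ e (f e))
    (σs : E → ℝ → ℝ)
    (hσs : ∀ e (te : ℝ), σs e te =
      fbar e * ((te - tbar e) / (tbar e * ρ)) ^ μ * (te - tbar e) / (1 + μ))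
    (Q : (E → ℝ) → ℝ) (hQ : ∀ t : E → ℝ, Q t = Φ t + ∑ e, σs e (t e))
    (ε : ℝ) (hε : 0 < ε)
    (N : ℕ) (hN : 0 < N)
    (tv : ℕ → E → ℝ) (htv : ∀ k, k ≤ N → ∀ e, tbar e ≤ tv k e)
    (L : ℕ → ℝ) (hL : ∀ k, 1 ≤ k → k ≤ N → 0 < L k)
    (gv : ℕ → E → ℝ)
    (hgsub : ∀ k, k < N → ∀ s : E → ℝ, Φ (tv k) + ∑ e, gv k e * (s e - tv k e) ≤ Φ s)
    (xv : ℕ → P → ℝ)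
    (hxv0 : ∀ k, k < N → ∀ p, 0 ≤ xv k p)
    (hxvd : ∀ k, k < N → ∀ w, ∑ p ∈ univ.filter (fun p => wOD p = w), xv k p = d w)
    (hgx : ∀ k, k < N → ∀ e, gv k e = -(∑ p, a p e * xv k p))
    (S : ℝ) (hS : S = ∑ k ∈ range N, 1 / L (k + 1))
    (that : E → ℝ)
    (hthat : ∀ e, that e = (1 / S) * ∑ k ∈ range N, tv (k + 1) e / L (k + 1))
    (fhat : E → ℝ)
    (hfhat : ∀ e, fhat e = -((1 / S) * ∑ k ∈ range N, gv k e / L (k + 1)))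
    (hUGI : ∀ t : E → ℝ, (∀ e, tbar e ≤ t e) →
      Q that ≤ (1 / S) * ∑ k ∈ range N, (1 / L (k + 1)) *
          (Φ (tv k) + ∑ e, gv k e * (t e - tv k e))
        + ∑ e, σs e (t e) + (∑ e, (t e - tbar e) ^ 2) / S + ε / 2)
    (tstar : E → ℝ) (htstar : ∀ e, tbar e ≤ tstar e)
    (htstar_min : ∀ t : E → ℝ, (∀ e, tbar e ≤ t e) → Q tstar ≤ Q t)
    (R : ℝ) (hR : R = Real.sqrt (∑ e, (tstar e - tbar e) ^ 2)) :
    (Q that - Q tstar ≤ R ^ 2 / S + ε / 2) ∧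
    (0 ≤ Q that + Ψ fhat ∧
      Q that + Ψ fhat ≤ (∑ e, (τ e (fhat e) - tbar e) ^ 2) / S + ε / 2) := by
  have hL' : ∀ k ∈ range N, 0 < 1 / L (k + 1) := fun k hk =>
    one_div_pos.2 (hL _ (by omega) (by have := mem_range.1 hk; omega))
  have hSpos : 0 < S := hS ▸ sum_pos hL' (nonempty_range_iff.2 hN.ne')
  have avg_le : ∀ (F : ℕ → ℝ) (C : ℝ), (∀ k ∈ range N, F k ≤ C) →
      (1 / S) * ∑ k ∈ range N, (1 / L (k + 1)) * F k ≤ C := by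
    intro F C h
    rw [one_div_mul_eq_div, div_le_iff₀ hSpos]
    rw [hS]
    rw [mul_sum]
    exact sum_le_sum fun k hk => by nlinarith [h k hk, hL' k hk]
  have le_avg : ∀ (F : ℕ → ℝ) (C : ℝ), (∀ k ∈ range N, C ≤ F k) →
      C ≤ (1 / S) * ∑ k ∈ range N, (1 / L (k + 1)) * F k := by
    intro F C h
    have := avg_le (fun k => -F k) (-C) fun k hk => neg_le_neg (h k hk)
    simp only [mul_neg, sum_neg_distrib] at this
    linarith
  have hfhat_inner : ∀ t : E → ℝ, ∑ e, t e * fhat e =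
      -((1 / S) * ∑ k ∈ range N, (1 / L (k + 1)) * ∑ e, gv k e * t e) := by
    intro t
    simp only [hfhat, mul_neg, sum_neg_distrib, mul_sum]
    rw [sum_comm]
    exact congrArg _ (sum_congr rfl fun k _ => sum_congr rfl fun e _ => by ring)
  have hthat_ge : ∀ e, tbar e ≤ that e := by
    intro e
    rw [hthat]
    have := le_avg (fun k => tv (k + 1) e) (tbar e) fun k hk =>
      htv _ (by have := mem_range.1 hk; omega) e
    simpa only [one_div_mul_eq_div] using this
  have hfhat_nonneg : ∀ e, 0 ≤ fhat e := by
    intro e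
    rw [hfhat, neg_nonneg]
    have := avg_le (fun k => gv k e) 0 fun k hk => by
      have hk' := mem_range.1 hk
      rw [hgx k hk', neg_nonpos]
      refine sum_nonneg fun p _ => mul_nonneg ?_ (hxv0 k hk' p)
      rcases ha p e with h | h <;> simp [h]
    simpa only [one_div_mul_eq_div] using this
  have hΦ0 : Φ 0 = 0 := by simp [hΦ]
  refine ⟨?_, ?_, ?_⟩
  · have hlin := avg_le _ (Φ tstar) fun k hk => hgsub k (mem_range.1 hk) tstar
    have hR2 : R ^ 2 = ∑ e, (tstar e - tbar e) ^ 2 := by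
      rw [hR, Real.sq_sqrt (sum_nonneg fun e _ => sq_nonneg _)]
    have h := hUGI tstar htstar
    rw [hQ tstar, hR2]
    linarith
  · have hsupp : -∑ e, that e * fhat e ≤ Φ that := by
      rw [hfhat_inner, neg_neg]
      refine avg_le _ _ fun k hk => ?_
      have hk' := mem_range.1 hk
      have h := sum_demand_mul_inf'_le a wOD d hne (xv k) (hxv0 k hk') (hxvd k hk') that
      simp only [hΦ, hgx k hk', neg_mul, sum_neg_distrib]
      exact neg_le_neg h
    have hFY : ∑ e, that e * fhat e ≤ ∑ e, σ e (fhat e) + ∑ e, σs e (that e) := by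
      rw [← sum_add_distrib]
      refine sum_le_sum fun e _ => ?_
      simp only [hσ, hσs, hτ]
      exact fenchel_young_beckmann (htbar e) (hfbar e) hρ hμ0 (hfhat_nonneg e) (hthat_ge e)
    rw [hQ, hΨ]
    linarith
  · have hτ_ge : ∀ e, tbar e ≤ τ e (fhat e) := by
      intro e
      rw [hτ]
      have : 0 ≤ ρ * (fhat e / fbar e) ^ (1 / μ) :=
        mul_nonneg hρ.le (Real.rpow_nonneg (div_nonneg (hfhat_nonneg e) (hfbar e).le) _)
      nlinarith [htbar e]
    have h := hUGI (fun e => τ e (fhat e)) hτ_ge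
    have hlin : (1 / S) * ∑ k ∈ range N, (1 / L (k + 1)) *
        (Φ (tv k) + ∑ e, gv k e * (τ e (fhat e) - tv k e)) ≤
        -∑ e, τ e (fhat e) * fhat e := by
      rw [hfhat_inner fun e => τ e (fhat e), neg_neg]
      refine mul_le_mul_of_nonneg_left (sum_le_sum fun k hk => ?_) (by positivity)
      refine mul_le_mul_of_nonneg_left ?_ (hL' k hk).le
      have h0 := hgsub k (mem_range.1 hk) 0
      simp only [hΦ0, Pi.zero_apply, zero_sub, mul_neg, sum_neg_distrib] at h0
      simp only [mul_sub, sum_sub_distrib]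
      linarith
    have hFY : ∑ e, σ e (fhat e) + ∑ e, σs e (τ e (fhat e)) =
        ∑ e, τ e (fhat e) * fhat e := by
      rw [← sum_add_distrib]
      refine sum_congr rfl fun e _ => ?_
      simp only [hσ, hσs, hτ]
      exact fenchel_young_beckmann_eq (htbar e) (hfbar e) hρ hμ0 (hfhat_nonneg e)
    rw [hΨ]
    linarith
end

section
/- Lemma 3.5 (UMST for the stable dynamics model): assume points t^N, y^1, …, y^N ≥ t̄, positive weights α_1, …, α_N with A_N = ∑_{k=1}^N α_k, and subgradients g^k of Φ at y^k with −g^k = Θx^k for some x^k ∈ X satisfy Q(t^N) ≤ min_{t ≥ t̄} { (1/A_N) ∑_{k=1}^{N} α_k [Φ(y^k) + ⟨g^k, t − y^k⟩] + ⟨t − t̄, f̄⟩ + ‖t − t̄‖₂²/(2A_N) } + ε/2, and set f̂^N = −(1/A_N) ∑_{k=1}^N α_k g^k. Let t* minimize Q over {t ≥ t̄} and R = ‖t* − t̄‖₂. Then: (i) Q(t^N) − Q(t*) ≤ R²/A_N + ε/2; (ii) 0 ≤ Q(t^N) + Ψ(f̂^N) + ⟨t* − t̄, (f̂^N − f̄)₊⟩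 ≤ R²/A_N + ε/2; and (iii) ‖(f̂^N − f̄)₊‖₂ ≤ 4R/A_N + √(2ε/A_N), where (v)₊ is the coordinatewise positive part. -/
open Finset

/-- A subgradient `g` at `y` of a function with `Φ 0 = 0` and `Φ (2 y) ≤ 2 Φ y` satisfies
the Euler identity `Φ y = ⟨g, y⟩`. -/
theorem eq_sum_mul_of_subgradient {E : Type*} [Fintype E] {Φ : (E → ℝ) → ℝ} {y g : E → ℝ}
    (h0 : Φ 0 = 0) (h2 : Φ (fun e => 2 * y e) ≤ 2 * Φ y)
    (hg : ∀ s : E → ℝ, Φ y + ∑ e, g e * (s e - y e) ≤ Φ s) :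
    Φ y = ∑ e, g e * y e := by
  have hzero := hg 0
  have htwo := hg (fun e => 2 * y e)
  have e0 : ∑ e, g e * ((0 : E → ℝ) e - y e) = -∑ e, g e * y e := by
    simp
  have e2 : ∑ e, g e * (2 * y e - y e) = ∑ e, g e * y e :=
    sum_congr rfl fun e _ => by ring
  rw [e0, h0] at hzero
  simp only [e2] at htwo
  linarith

theorem two_mul_inf'_le_inf' {ι E : Type*} [Fintype E] {s : Finset ι} (hs : s.Nonempty)
    (a : ι → E → ℝ) (t : E → ℝ) :
    2 * s.inf' hs (fun p => ∑ e, t e * a p e) ≤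
      s.inf' hs (fun p => ∑ e, 2 * t e * a p e) := by
  refine le_inf' hs _ fun p hp => ?_
  have h := inf'_le (fun p => ∑ e, t e * a p e) hp
  have h2 : ∑ e, 2 * t e * a p e = 2 * ∑ e, t e * a p e := by
    rw [mul_sum]
    exact sum_congr rfl fun e _ => by ring
  rw [h2]
  linarith

theorem le_add_sqrt_of_quadratic_le {A R V ε : ℝ} (hA : 0 < A) (hR : 0 ≤ R) (hε : 0 < ε)
    (h : A / 2 * V ^ 2 ≤ R * V + ε / 2) :
    V ≤ 4 * R / A + √(2 * ε / A) := by
  have hS : 0 < √(2 * ε / A) := Real.sqrt_pos.2 (by positivity)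
  have hS2 : √(2 * ε / A) ^ 2 = 2 * ε / A := Real.sq_sqrt (by positivity)
  set S := √(2 * ε / A)
  have hr : 0 ≤ R / A := by positivity
  have hV : V ^ 2 ≤ S ^ 2 / 2 + 2 * (R / A) * V := by
    rw [hS2]
    have : V ^ 2 = (A / 2 * V ^ 2) * (2 / A) := by field_simp
    rw [this]
    calc (A / 2 * V ^ 2) * (2 / A) ≤ (R * V + ε / 2) * (2 / A) := by gcongr
      _ = _ := by
        field_simp
        ring
  rw [mul_div_assoc]
  set r := R / A
  by_contra! hlt
  have hVS : S ≤ V := by linarith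
  have hmul : S * S ≤ V * (V - 2 * r) :=
    mul_le_mul hVS (by linarith) hS.le (by linarith)
  nlinarith [mul_pos hS hS]

/-- Lemma 3.5 (UMST for the stable dynamics model): under the UMST inequality
with weights `α_k`, `A_N = ∑_{k=1}^N α_k` and
`f̂^N = −(1/A_N) ∑_{k=1}^N α_k g^k`, one has
(i) `Q(t^N) − Q(t*) ≤ R²/A_N + ε/2`;
(ii) `0 ≤ Q(t^N) + Ψ(f̂^N) + ⟨t* − t̄, (f̂^N − f̄)₊⟩ ≤ R²/A_N + ε/2`;
(iii) `‖(f̂^N − f̄)₊‖₂ ≤ 4R/A_N + √(2ε/A_N)`. -/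
theorem umst_stable_dynamics_lemma
    (E P W : Type) [Fintype E] [Fintype P] [Fintype W] [DecidableEq W]
    (a : P → E → ℝ) (ha : ∀ p e, a p e = 0 ∨ a p e = 1)
    (wOD : P → W) (d : W → ℝ) (hd : ∀ w, 0 < d w)
    (hne : ∀ w : W, (univ.filter (fun p => wOD p = w)).Nonempty)
    (Φ : (E → ℝ) → ℝ)
    (hΦ : ∀ t : E → ℝ, Φ t = -∑ w, d w *
        (univ.filter (fun p => wOD p = w)).inf' (hne w) (fun p => ∑ e, t e * a p e))
    (tbar fbar : E → ℝ) (htbar : ∀ e, 0 < tbar e) (hfbar : ∀ e, 0 < fbar e)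
    (Ψ : (E → ℝ) → ℝ) (hΨ : ∀ f : E → ℝ, Ψ f = ∑ e, tbar e * f e)
    (Q : (E → ℝ) → ℝ) (hQ : ∀ t : E → ℝ, Q t = Φ t + ∑ e, (t e - tbar e) * fbar e)
    (ε : ℝ) (hε : 0 < ε)
    (N : ℕ) (hN : 0 < N)
    (tN : E → ℝ) (htN : ∀ e, tbar e ≤ tN e)
    (yv : ℕ → E → ℝ) (hyv : ∀ k, 1 ≤ k → k ≤ N → ∀ e, tbar e ≤ yv k e)
    (α : ℕ → ℝ) (hα : ∀ k, 1 ≤ k → k ≤ N → 0 < α k)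
    (A : ℝ) (hA : A = ∑ k ∈ range N, α (k + 1))
    (gv : ℕ → E → ℝ)
    (hgsub : ∀ k, 1 ≤ k → k ≤ N →
      ∀ s : E → ℝ, Φ (yv k) + ∑ e, gv k e * (s e - yv k e) ≤ Φ s)
    (xv : ℕ → P → ℝ)
    (hxv0 : ∀ k, 1 ≤ k → k ≤ N → ∀ p, 0 ≤ xv k p)
    (hxvd : ∀ k, 1 ≤ k → k ≤ N →
      ∀ w, ∑ p ∈ univ.filter (fun p => wOD p = w), xv k p = d w)
    (hgx : ∀ k, 1 ≤ k → k ≤ N → ∀ e, gv k e = -(∑ p, a p e * xv k p))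
    (fhat : E → ℝ)
    (hfhat : ∀ e, fhat e = -((1 / A) * ∑ k ∈ range N, α (k + 1) * gv (k + 1) e))
    (hUMST : ∀ t : E → ℝ, (∀ e, tbar e ≤ t e) →
      Q tN ≤ (1 / A) * ∑ k ∈ range N, α (k + 1) *
          (Φ (yv (k + 1)) + ∑ e, gv (k + 1) e * (t e - yv (k + 1) e))
        + ∑ e, (t e - tbar e) * fbar e + (∑ e, (t e - tbar e) ^ 2) / (2 * A) + ε / 2)
    (tstar : E → ℝ) (htstar : ∀ e, tbar e ≤ tstar e)
    (htstar_min : ∀ t : E → ℝ, (∀ e, tbar e ≤ t e) → Q tstar ≤ Q t)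
    (R : ℝ) (hR : R = Real.sqrt (∑ e, (tstar e - tbar e) ^ 2)) :
    (Q tN - Q tstar ≤ R ^ 2 / A + ε / 2) ∧
    (0 ≤ Q tN + Ψ fhat + ∑ e, (tstar e - tbar e) * max (fhat e - fbar e) 0 ∧
      Q tN + Ψ fhat + ∑ e, (tstar e - tbar e) * max (fhat e - fbar e) 0
        ≤ R ^ 2 / A + ε / 2) ∧
    (Real.sqrt (∑ e, max (fhat e - fbar e) 0 ^ 2)
      ≤ 4 * R / A + Real.sqrt (2 * ε / A)) := by
  have hApos : 0 < A := by
    rw [hA]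
    refine sum_pos (fun k hk => hα _ (by omega) ?_) (nonempty_range_iff.2 hN.ne')
    have := mem_range.1 hk
    omega
  have hΦ0 : Φ 0 = 0 := by simp [hΦ]
  have hΦ2 : ∀ y : E → ℝ, Φ (fun e => 2 * y e) ≤ 2 * Φ y := by
    intro y
    rw [hΦ, hΦ, mul_neg, neg_le_neg_iff, mul_sum]
    refine sum_le_sum fun w _ => ?_
    rw [mul_left_comm]
    exact mul_le_mul_of_nonneg_left (two_mul_inf'_le_inf' (hne w) a y) (hd w).le
  have hlin : ∀ k ∈ range N, ∀ t : E → ℝ,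
      Φ (yv (k + 1)) + ∑ e, gv (k + 1) e * (t e - yv (k + 1) e) =
        ∑ e, gv (k + 1) e * t e := by
    intro k hk t
    have hk' := mem_range.1 hk
    rw [eq_sum_mul_of_subgradient hΦ0 (hΦ2 _) (hgsub (k + 1) (by omega) (by omega)),
      ← sum_add_distrib]
    exact sum_congr rfl fun e _ => by ring
  have havg : ∀ t : E → ℝ, (1 / A) * ∑ k ∈ range N, α (k + 1) *
      (Φ (yv (k + 1)) + ∑ e, gv (k + 1) e * (t e - yv (k + 1) e)) = -∑ e, fhat e * t e := by
    intro t
    rw [sum_congr rfl fun k hk => by rw [hlin k hk t]]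
    simp only [hfhat, mul_sum, sum_mul, neg_mul, sum_neg_distrib, neg_neg]
    rw [sum_comm]
    exact sum_congr rfl fun e _ => sum_congr rfl fun k _ => by ring
  have hΦlow : ∀ t : E → ℝ, -∑ e, fhat e * t e ≤ Φ t := by
    intro t
    rw [← havg, one_div, inv_mul_le_iff₀ hApos, hA, sum_mul]
    refine sum_le_sum fun k hk => ?_
    have hk' := mem_range.1 hk
    exact mul_le_mul_of_nonneg_left (hgsub _ (by omega) (by omega) t)
      (hα _ (by omega) (by omega)).le
  have hRsq : R ^ 2 = ∑ e, (tstar e - tbar e) ^ 2 := by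
    rw [hR, Real.sq_sqrt (sum_nonneg fun e _ => sq_nonneg _)]
  have hR0 : 0 ≤ R := hR ▸ Real.sqrt_nonneg _
  have hhalf : R ^ 2 / (2 * A) ≤ R ^ 2 / A := by
    gcongr
    linarith
  set v : E → ℝ := fun e => max (fhat e - fbar e) 0 with hv
  have hv0 : ∀ e, 0 ≤ v e := fun e => le_max_right _ _
  have hvmul : ∀ e, (fhat e - fbar e) * v e = v e ^ 2 := by
    intro e
    rcases le_total (fhat e - fbar e) 0 with h | h
    · simp [hv, max_eq_right h]
    · simp only [hv, max_eq_left h]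
      ring
  change _ ∧ (0 ≤ Q tN + Ψ fhat + ∑ e, (tstar e - tbar e) * v e ∧
    Q tN + Ψ fhat + ∑ e, (tstar e - tbar e) * v e ≤ _) ∧ √(∑ e, v e ^ 2) ≤ _
  have hcs : ∑ e, (tstar e - tbar e) * v e ≤ R * √(∑ e, v e ^ 2) := by
    rw [hR]
    exact Real.sum_mul_le_sqrt_mul_sqrt _ _ _
  have hVsq : √(∑ e, v e ^ 2) ^ 2 = ∑ e, v e ^ 2 :=
    Real.sq_sqrt (sum_nonneg fun e _ => sq_nonneg _)
  have hV0 : 0 ≤ √(∑ e, v e ^ 2) := Real.sqrt_nonneg _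
  set V := √(∑ e, v e ^ 2)
  have hgap : Q tN + Ψ fhat + A / 2 * V ^ 2 ≤ ε / 2 := by
    have h := hUMST (fun e => tbar e + A * v e)
      fun e => le_add_of_nonneg_right (mul_nonneg hApos.le (hv0 e))
    rw [havg] at h
    have h1 : -∑ e, fhat e * (tbar e + A * v e) + ∑ e, (tbar e + A * v e - tbar e) * fbar e =
        -Ψ fhat - A * V ^ 2 := by
      rw [hΨ, hVsq, mul_sum, ← sum_neg_distrib, ← sum_neg_distrib, ← sum_add_distrib,
        ← sum_sub_distrib]
      refine sum_congr rfl fun e _ => ?_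
      rw [← hvmul]
      ring
    have h2 : (∑ e, (tbar e + A * v e - tbar e) ^ 2) / (2 * A) = A / 2 * V ^ 2 := by
      have h3 : ∑ e, (tbar e + A * v e - tbar e) ^ 2 = A ^ 2 * V ^ 2 := by
        rw [hVsq, mul_sum]
        exact sum_congr rfl fun e _ => by ring
      rw [h3]
      field_simp
    linarith
  have hnonneg : 0 ≤ Q tN + Ψ fhat + ∑ e, (tstar e - tbar e) * v e := by
    have hmin := htstar_min tN htN
    have hlow := hΦlow tstar
    have hQs := hQ tstar
    have hsum : ∑ e, fhat e * tstar e ≤ ∑ e, (tstar e - tbar e) * fbar e + Ψ fhat +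
        ∑ e, (tstar e - tbar e) * v e := by
      rw [hΨ, ← sum_add_distrib, ← sum_add_distrib]
      refine sum_le_sum fun e _ => ?_
      have := mul_le_mul_of_nonneg_left (le_max_left (fhat e - fbar e) 0)
        (sub_nonneg.2 (htstar e))
      simp only [hv]
      linarith
    linarith
  refine ⟨?_, ⟨hnonneg, ?_⟩, le_add_sqrt_of_quadratic_le hApos hR0 hε (by linarith)⟩
  · have h := hUMST tstar htstar
    rw [havg, ← hRsq] at h
    linarith [hΦlow tstar, hQ tstar]
  · have hyoung : R * V ≤ A / 2 * V ^ 2 + R ^ 2 / (2 * A) := by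
      have h : A / 2 * V ^ 2 + R ^ 2 / (2 * A) - R * V = (A * V - R) ^ 2 / (2 * A) := by
        field_simp
        ring
      have : 0 ≤ (A * V - R) ^ 2 / (2 * A) := by positivity
      linarith
    linarith
end
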